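/- arXiv:1408.4755 — 2 statements merged into one kernel-verified Lean document; each statement's English description precedes it below -/
import Mathlib

section
/- The entropy of a multivariate skew-normal vector Y ~ SN_n(μ, Σ, α) equals H_{N_n(μ,Σ)} − E[ln(2Φ(ᾱ'Z₀))], where Z₀ ~ SN_n(0, I_n, ᾱ). -/
open MeasureTheory Real Matrix

/-- Density of `N_k(0, V)` (for `V = 1` this is the standard `k`-variate normal density). -/
noncomputable def mvphi (k : ℕ) (V : Matrix (Fin k) (Fin k) ℝ) (z : Fin k → ℝ) : ℝ :=
  (2 * Real.pi) ^ (-(k : ℝ) / 2) * (Real.sqrt V.det)⁻¹ * Real.exp (-(z ⬝ᵥ (V⁻¹ *ᵥ z)) / 2)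

/-- CDF `Φ_k(x | V)` of `N_k(0, V)`. -/
noncomputable def mvPhi (k : ℕ) (V : Matrix (Fin k) (Fin k) ℝ) (x : Fin k → ℝ) : ℝ :=
  ∫ t in Set.Iic x, mvphi k V t

/-- Univariate standard normal density. -/
noncomputable def stdphi (x : ℝ) : ℝ := (Real.sqrt (2 * Real.pi))⁻¹ * Real.exp (-(x ^ 2) / 2)

/-- Univariate standard normal CDF `Φ`. -/
noncomputable def stdPhi (x : ℝ) : ℝ := ∫ t in Set.Iic x, stdphi t

open ProbabilityTheory

lemma aux_stdphi_eq (x : ℝ) : stdphi x = gaussianPDFReal 0 1 x := by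
  simp [stdphi, gaussianPDFReal]

lemma aux_stdphi_eq' : stdphi = gaussianPDFReal 0 1 := funext aux_stdphi_eq

lemma aux_int : Integrable stdphi := by
  rw [aux_stdphi_eq']; exact integrable_gaussianPDFReal 0 1

lemma aux_integral : ∫ x, stdphi x = 1 := by
  rw [aux_stdphi_eq']; exact integral_gaussianPDFReal_eq_one 0 (by norm_num)

lemma aux_pos (x : ℝ) : 0 < stdphi x := by
  rw [aux_stdphi_eq']; exact gaussianPDFReal_pos 0 1 x (by norm_num)

lemma aux_sq : ∫ x, x ^ 2 * stdphi x = 1 := by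
  have h := variance_fun_id_gaussianReal (μ := 0) (v := 1)
  rw [variance_eq_integral (by fun_prop)] at h
  simp only [integral_id_gaussianReal, sub_zero] at h
  rw [integral_gaussianReal_eq_integral_smul (by norm_num)] at h
  simp only [smul_eq_mul, ← aux_stdphi_eq] at h
  simpa [mul_comm] using h

lemma aux_sq_int : Integrable (fun x : ℝ => x ^ 2 * stdphi x) := by
  by_contra h
  have := aux_sq
  rw [integral_undef h] at this
  norm_num at this

lemma stdPhi_mono : Monotone stdPhi := by
  intro a b hab
  exact setIntegral_mono_set aux_int.integrableOn (ae_of_all _ fun x => (aux_pos x).le)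
    (Set.Iic_subset_Iic.2 hab).eventuallyLE

lemma stdPhi_add (x : ℝ) : stdPhi x + stdPhi (-x) = 1 := by
  have h1 : stdPhi (-x) = ∫ t in Set.Ioi x, stdphi t := by
    have := integral_comp_neg_Iic (-x) stdphi
    rw [neg_neg] at this
    rw [← this]
    simp [stdPhi, stdphi]
  rw [h1, stdPhi, ← aux_integral]
  exact intervalIntegral.integral_Iic_add_Ioi aux_int.integrableOn aux_int.integrableOn

lemma stdPhi_pos (x : ℝ) : 0 < stdPhi x := by
  unfold stdPhi
  rw [setIntegral_pos_iff_support_of_nonneg_ae (ae_of_all _ fun x => (aux_pos x).le)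
    aux_int.integrableOn]
  have : Function.support stdphi = Set.univ := by
    ext y; simp [(aux_pos y).ne']
  rw [this]; simp

lemma stdPhi_le (x : ℝ) : stdPhi x ≤ 1 := by
  linarith [stdPhi_add x, stdPhi_pos (-x)]

lemma mvphi_eq (n : ℕ) (z : Fin n → ℝ) :
    mvphi n 1 z = (2 * π) ^ (-(n : ℝ) / 2) * Real.exp (-(∑ i, z i ^ 2) / 2) := by
  simp [mvphi, dotProduct, pow_two]

lemma mvphi_prod (n : ℕ) (z : Fin n → ℝ) : mvphi n 1 z = ∏ i, stdphi (z i) := by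
  rw [mvphi_eq]
  simp only [stdphi, Finset.prod_mul_distrib, ← Real.exp_sum]
  congr 1
  · simp only [Finset.prod_const, Finset.card_univ, Fintype.card_fin]
    rw [Real.sqrt_eq_rpow, ← Real.rpow_neg (by positivity), ← Real.rpow_natCast,
      ← Real.rpow_mul (by positivity)]
    congr 1; ring
  · rw [← Finset.sum_div, Finset.sum_neg_distrib]

lemma mvphi_pos (n : ℕ) (z : Fin n → ℝ) : 0 < mvphi n 1 z := by
  rw [mvphi_prod]; exact Finset.prod_pos fun i _ => aux_pos _

lemma mvphi_neg (n : ℕ) (z : Fin n → ℝ) : mvphi n 1 (-z) = mvphi n 1 z := by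
  simp [mvphi_eq]

lemma mvphi_int (n : ℕ) : Integrable (fun z : Fin n → ℝ => mvphi n 1 z) := by
  simp only [mvphi_prod]
  exact Integrable.fintype_prod fun _ => aux_int

lemma mvphi_integral (n : ℕ) : ∫ z : Fin n → ℝ, mvphi n 1 z = 1 := by
  simp only [mvphi_prod]
  rw [integral_fintype_prod_volume_eq_prod (fun _ => stdphi)]
  simp [aux_integral]

lemma mvphi_sq_prod (n : ℕ) (i : Fin n) (z : Fin n → ℝ) : z i ^ 2 * mvphi n 1 z =
    ∏ j, (fun x : ℝ => (if j = i then x ^ 2 else 1) * stdphi x) (z j) := by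
  rw [mvphi_prod]
  rw [Finset.prod_mul_distrib, Finset.prod_ite_eq' Finset.univ i (fun j => z j ^ 2)]
  simp

lemma mvphi_sq_int (n : ℕ) (i : Fin n) :
    Integrable (fun z : Fin n → ℝ => z i ^ 2 * mvphi n 1 z) := by
  simp only [mvphi_sq_prod]
  refine Integrable.fintype_prod
    (f := fun j (x : ℝ) => (if j = i then x ^ 2 else 1) * stdphi x) fun j => ?_
  by_cases h : j = i
  · simpa [h] using aux_sq_int
  · simpa [h] using aux_int

lemma mvphi_sq_integral (n : ℕ) (i : Fin n) :
    ∫ z : Fin n → ℝ, z i ^ 2 * mvphi n 1 z = 1 := by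
  simp only [mvphi_sq_prod]
  rw [integral_fintype_prod_volume_eq_prod
    (fun j (x : ℝ) => (if j = i then x ^ 2 else 1) * stdphi x)]
  refine Finset.prod_eq_one fun j _ => ?_
  by_cases h : j = i
  · simpa [h] using aux_sq
  · simpa [h] using aux_integral

lemma norm_int (n : ℕ) :
    Integrable (fun z : Fin n → ℝ => (∑ i, z i ^ 2) * mvphi n 1 z) := by
  simp only [Finset.sum_mul]
  exact integrable_finsetSum _ fun i _ => mvphi_sq_int n i

lemma norm_integral (n : ℕ) :
    ∫ z : Fin n → ℝ, (∑ i, z i ^ 2) * mvphi n 1 z = n := by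
  simp only [Finset.sum_mul]
  rw [integral_finsetSum _ fun i _ => mvphi_sq_int n i]
  simp [mvphi_sq_integral]

lemma meas_g {n : ℕ} (α : Fin n → ℝ) : Measurable (fun z : Fin n → ℝ => stdPhi (α ⬝ᵥ z)) := by
  refine stdPhi_mono.measurable.comp ?_
  unfold dotProduct
  fun_prop

lemma skew_int {n : ℕ} (α : Fin n → ℝ) (h : (Fin n → ℝ) → ℝ) (hi : Integrable h) :
    Integrable (fun z => h z * stdPhi (α ⬝ᵥ z)) := by
  refine hi.mul_bdd (c := 1) (meas_g α).aestronglyMeasurable (ae_of_all _ fun z => ?_)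
  rw [Real.norm_of_nonneg (stdPhi_pos _).le]
  exact stdPhi_le _

lemma skew_integral {n : ℕ} (α : Fin n → ℝ) (h : (Fin n → ℝ) → ℝ) (hi : Integrable h)
    (he : ∀ z, h (-z) = h z) :
    ∫ z, h z * stdPhi (α ⬝ᵥ z) = (∫ z, h z) / 2 := by
  have h1 := integral_neg_eq_self (fun z => h z * stdPhi (α ⬝ᵥ z)) volume
  have h2 : ∀ z, h (-z) * stdPhi (α ⬝ᵥ (-z)) = h z - h z * stdPhi (α ⬝ᵥ z) := by
    intro z
    rw [he, dotProduct_neg]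
    have := stdPhi_add (α ⬝ᵥ z)
    rw [eq_sub_of_add_eq' this]; ring
  simp only [h2] at h1
  rw [integral_sub hi (skew_int α h hi)] at h1
  linarith

lemma xlogx_bound (x : ℝ) (h0 : 0 < x) (h2 : x ≤ 2) : |x * Real.log x| ≤ 2 := by
  have h3 := Real.log_le_sub_one_of_pos h0
  have h4 := Real.one_sub_inv_le_log_of_pos h0
  rw [abs_le]
  constructor
  · have : x * (1 - x⁻¹) ≤ x * Real.log x := by gcongr
    have e : x * (1 - x⁻¹) = x - 1 := by field_simp
    linarith
  · have : x * Real.log x ≤ x * (x - 1) := by gcongr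
    nlinarith

lemma log_int {n : ℕ} (α : Fin n → ℝ) :
    Integrable (fun z => 2 * mvphi n 1 z * stdPhi (α ⬝ᵥ z) * Real.log (2 * stdPhi (α ⬝ᵥ z))) := by
  have : Integrable (fun z => mvphi n 1 z *
      ((2 * stdPhi (α ⬝ᵥ z)) * Real.log (2 * stdPhi (α ⬝ᵥ z)))) := by
    have m : Measurable (fun z => 2 * stdPhi (α ⬝ᵥ z)) := (meas_g α).const_mul 2
    refine (mvphi_int n).mul_bdd (c := 2) (m.mul m.log).aestronglyMeasurable
      (ae_of_all _ fun z => ?_)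
    rw [Real.norm_eq_abs]
    exact xlogx_bound _ (by linarith [stdPhi_pos (α ⬝ᵥ z)]) (by linarith [stdPhi_le (α ⬝ᵥ z)])
  refine this.congr (ae_of_all _ fun z => ?_)
  simp only; ring

lemma change_var {n : ℕ} (M : Matrix (Fin n) (Fin n) ℝ) (hM : M.det ≠ 0) (μ : Fin n → ℝ)
    (F : (Fin n → ℝ) → ℝ) (hF : Measurable F) :
    ∫ y, F (M *ᵥ (y - μ)) = |M.det⁻¹| * ∫ z, F z := by
  rw [integral_sub_right_eq_self (fun y => F (M *ᵥ y)) μ]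
  have h := Real.map_matrix_volume_pi_eq_smul_volume_pi hM
  have hm : Measurable (toLin' M) := by
    exact (LinearMap.continuous_of_finiteDimensional _).measurable
  have h2 := integral_map (μ := volume) hm.aemeasurable
    (f := F) hF.aestronglyMeasurable
  rw [h, integral_smul_measure] at h2
  simp only [toLin'_apply] at h2
  rw [← h2]
  simp

/-- The entropy of a multivariate skew-normal vector `Y ~ SN_n(μ, Σ, ᾱ)` equals
`H_{N_n(μ,Σ)} − E[ln(2Φ(ᾱ'Z₀))]` where `Z₀ ~ SN_n(0, I_n, ᾱ)`. -/
theorem entropy_multivariate_skew_normal (n : ℕ) (μ : Fin n → ℝ)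
    (Sig S : Matrix (Fin n) (Fin n) ℝ) (hS : S.PosDef) (hSS : S * S = Sig)
    (α : Fin n → ℝ) (f f₀ : (Fin n → ℝ) → ℝ)
    (hf : ∀ y, f y = 2 * (Real.sqrt Sig.det)⁻¹ * mvphi n 1 (S⁻¹ *ᵥ (y - μ)) *
      stdPhi (α ⬝ᵥ (S⁻¹ *ᵥ (y - μ))))
    (hf₀ : ∀ z, f₀ z = 2 * mvphi n 1 z * stdPhi (α ⬝ᵥ z)) :
    -∫ y, f y * Real.log (f y) =
      ((1 / 2) * Real.log Sig.det + ((n : ℝ) / 2) * (1 + Real.log (2 * π)))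
        - ∫ z, f₀ z * Real.log (2 * stdPhi (α ⬝ᵥ z)) := by
  have hd : 0 < S.det := hS.det_pos
  have hSd : Sig.det = S.det * S.det := by rw [← hSS, det_mul]
  have hsq : Real.sqrt Sig.det = S.det := by rw [hSd, Real.sqrt_mul_self hd.le]
  have hlog : Real.log Sig.det = 2 * Real.log S.det := by
    rw [hSd, Real.log_mul hd.ne' hd.ne']; ring
  have hp : (0 : ℝ) < 2 * π := by positivity
  set K : ℝ := -Real.log S.det - (n : ℝ) / 2 * Real.log (2 * π) with hK
  have hmf : Measurable f₀ := by
    have : f₀ = fun z => 2 * mvphi n 1 z * stdPhi (α ⬝ᵥ z) := funext hf₀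
    rw [this]
    refine Measurable.mul ?_ (meas_g α)
    simp only [mvphi_eq]
    fun_prop
  have hpos : ∀ z, 0 < f₀ z := fun z => by
    rw [hf₀]; exact mul_pos (mul_pos two_pos (mvphi_pos n z)) (stdPhi_pos _)
  have hff : ∀ y, f y = S.det⁻¹ * f₀ (S⁻¹ *ᵥ (y - μ)) := fun y => by
    rw [hf, hf₀, hsq]; ring
  have hMd : (S⁻¹).det = S.det⁻¹ := by rw [det_nonsing_inv, Ring.inverse_eq_inv']
  have step1 : ∫ y, f y * Real.log (f y) = ∫ z, f₀ z * Real.log (S.det⁻¹ * f₀ z) := by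
    simp only [hff]
    rw [change_var S⁻¹ (by rw [hMd]; positivity) μ
      (fun z => S.det⁻¹ * f₀ z * Real.log (S.det⁻¹ * f₀ z))
      (by exact (hmf.const_mul _).mul (hmf.const_mul _).log), hMd, inv_inv, abs_of_pos hd,
      ← integral_const_mul]
    congr 1; ext z
    field_simp
  have step2 : ∀ z, f₀ z * Real.log (S.det⁻¹ * f₀ z) =
      2 * K * (mvphi n 1 z * stdPhi (α ⬝ᵥ z))
      - ((∑ i, z i ^ 2) * mvphi n 1 z) * stdPhi (α ⬝ᵥ z)
      + 2 * mvphi n 1 z * stdPhi (α ⬝ᵥ z) * Real.log (2 * stdPhi (α ⬝ᵥ z)) := fun z => by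
    have e1 : S.det⁻¹ * f₀ z = S.det⁻¹ * (mvphi n 1 z * (2 * stdPhi (α ⬝ᵥ z))) := by
      rw [hf₀]; ring
    have hg := stdPhi_pos (α ⬝ᵥ z)
    have e2 : Real.log (mvphi n 1 z) = -(n : ℝ) / 2 * Real.log (2 * π) - (∑ i, z i ^ 2) / 2 := by
      rw [mvphi_eq, Real.log_mul (by positivity) (by positivity), Real.log_rpow hp, Real.log_exp]
      ring
    rw [e1, Real.log_mul (by positivity) (mul_pos (mvphi_pos n z) (by positivity)).ne',
      Real.log_mul (mvphi_pos n z).ne' (by positivity), e2, Real.log_inv, hf₀, hK]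
    ring
  have i1 := skew_int α _ (mvphi_int n)
  have i2 := skew_int α _ (norm_int n)
  have v1 := skew_integral α _ (mvphi_int n) (mvphi_neg n)
  have v2 := skew_integral α _ (norm_int n) (fun z => by simp [mvphi_neg])
  rw [mvphi_integral] at v1
  rw [norm_integral] at v2
  rw [step1]
  simp only [step2]
  have i3 : Integrable (fun z => 2 * K * (mvphi n 1 z * stdPhi (α ⬝ᵥ z))
      - ((∑ i, z i ^ 2) * mvphi n 1 z) * stdPhi (α ⬝ᵥ z)) := (i1.const_mul (2 * K)).sub i2
  rw [integral_add i3 (log_int α),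
    integral_sub (i1.const_mul (2 * K)) i2, integral_const_mul, v1, v2, hlog, hK]
  simp only [hf₀]
  ring
end

section
/- If Z ~ LCFUSN_{n,m}(μ, Σ, Δ) (i.e., ln Z ~ CFUSN_{n,m}(μ, Σ, Δ) componentwise), then H_Z = H_{CFUSN_{n,m}(μ,Σ,Δ)} + Σ_{i=1}^n E(X_i), where X ~ CFUSN_{n,m}(μ, Σ, Δ). -/
open MeasureTheory Real Matrix

/-- The quadratically weighted Gaussian is integrable. -/
lemma aux_gauss (n : ℕ) (b : ℝ) (hb : 0 < b) :
    Integrable (fun z : Fin n → ℝ => Real.exp (-b * (z ⬝ᵥ z))) := by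
  have h := MeasureTheory.Integrable.fintype_prod (𝕜 := ℝ) (ι := Fin n)
    (μ := fun _ => (volume : Measure ℝ))
    (f := fun _ x => Real.exp (-b * x ^ 2)) (fun _ => integrable_exp_neg_mul_sq hb)
  rw [← volume_pi] at h
  refine h.congr (Filter.Eventually.of_forall fun z => ?_)
  simp only
  rw [← Real.exp_sum, dotProduct, Finset.mul_sum]
  simp [pow_two]

lemma aux_gauss_sq (n : ℕ) :
    Integrable (fun z : Fin n → ℝ => (1 + z ⬝ᵥ z) * Real.exp (-(z ⬝ᵥ z) / 2)) := by
  refine ((aux_gauss n (1/4) (by norm_num)).const_mul 4).mono' ?_ ?_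
  · apply Continuous.aestronglyMeasurable
    unfold dotProduct
    fun_prop
  · filter_upwards with z
    have h0 : 0 ≤ z ⬝ᵥ z := Finset.sum_nonneg fun i _ => mul_self_nonneg _
    rw [Real.norm_of_nonneg (by positivity)]
    have h1 := Real.add_one_le_exp ((z ⬝ᵥ z) / 4)
    have : Real.exp (-(1/4) * (z ⬝ᵥ z)) = Real.exp ((z ⬝ᵥ z) / 4) * Real.exp (-(z ⬝ᵥ z) / 2) := by
      rw [← Real.exp_add]; ring_nf
    rw [this, ← mul_assoc]
    gcongr
    linarith

lemma aux_comp (n : ℕ) (A : Matrix (Fin n) (Fin n) ℝ) (hA : A.det ≠ 0) (F : (Fin n → ℝ) → ℝ)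
    (hF : Integrable F) : Integrable (fun w => F (A *ᵥ w)) := by
  have h := Real.map_matrix_volume_pi_eq_smul_volume_pi hA
  have h2 : Integrable F (Measure.map (toLin' A) volume) := by
    rw [h]
    exact hF.smul_measure ENNReal.ofReal_ne_top
  have h3 := h2.comp_measurable (f := toLin' A) (by
    exact (LinearMap.continuous_on_pi _).measurable)
  exact h3

lemma aux_mvphi_int (k : ℕ) (V : Matrix (Fin k) (Fin k) ℝ) (hV : V.PosDef) :
    Integrable (mvphi k V) := by
  have hVi := hV.inv
  obtain ⟨B, hB⟩ : ∃ B : Matrix (Fin k) (Fin k) ℝ, V⁻¹ = Bᴴ * B := by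
    open scoped MatrixOrder in
    exact CStarAlgebra.nonneg_iff_eq_star_mul_self.mp hVi.posSemidef.nonneg
  have hdet : B.det ≠ 0 := by
    intro h
    have := hVi.det_pos
    rw [hB, det_mul, h] at this
    simp at this
  have := aux_comp k B hdet _ (aux_gauss k (1/2) (by norm_num))
  unfold mvphi
  refine Integrable.const_mul ?_ _
  convert this using 2 with z
  congr 1
  rw [hB, ← mulVec_mulVec, conjTranspose_eq_transpose_of_trivial, dotProduct_mulVec,
    vecMul_transpose]
  ring

lemma aux_mvphi_nonneg (k : ℕ) (V : Matrix (Fin k) (Fin k) ℝ) (z) : 0 ≤ mvphi k V z := by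
  unfold mvphi; positivity

lemma aux_mvphi_cont (k : ℕ) (V : Matrix (Fin k) (Fin k) ℝ) : Continuous (mvphi k V) := by
  unfold mvphi
  fun_prop

lemma aux_mvPhi_meas (k : ℕ) (V : Matrix (Fin k) (Fin k) ℝ) : Measurable (mvPhi k V) := by
  have h : StronglyMeasurable (fun p : (Fin k → ℝ) × (Fin k → ℝ) =>
      ({p : (Fin k → ℝ) × (Fin k → ℝ) | p.2 ≤ p.1}).indicator (fun p => mvphi k V p.2) p) := by
    apply StronglyMeasurable.indicator
    · exact ((aux_mvphi_cont k V).comp continuous_snd).stronglyMeasurable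
    · exact (isClosed_le continuous_snd continuous_fst).measurableSet
  have h2 := h.integral_prod_right' (ν := volume)
  convert h2.measurable using 2 with x
  unfold mvPhi
  rw [← integral_indicator measurableSet_Iic]
  rfl

lemma aux_posdef (n m : ℕ) (Δ : Matrix (Fin n) (Fin m) ℝ)
    (hΔ : ∀ a : Fin m → ℝ, a ⬝ᵥ a = 1 → (Δ *ᵥ a) ⬝ᵥ (Δ *ᵥ a) < 1) :
    (1 - Δᵀ * Δ).PosDef := by
  refine Matrix.PosDef.of_dotProduct_mulVec_pos ?_ ?_
  · simp [IsHermitian, conjTranspose_eq_transpose_of_trivial]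
  · intro x hx
    have h0 : 0 < x ⬝ᵥ x := by
      have := dotProduct_star_self_pos_iff.mpr hx
      simpa using this
    have hs : Real.sqrt (x ⬝ᵥ x) * Real.sqrt (x ⬝ᵥ x) = x ⬝ᵥ x := Real.mul_self_sqrt h0.le
    have hsp : 0 < Real.sqrt (x ⬝ᵥ x) := Real.sqrt_pos.mpr h0
    have h1 := hΔ ((Real.sqrt (x ⬝ᵥ x))⁻¹ • x) (by
      simp only [smul_dotProduct, dotProduct_smul, smul_eq_mul]
      rw [← mul_assoc, ← mul_inv, hs, inv_mul_cancel₀ h0.ne'])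
    simp only [mulVec_smul, smul_dotProduct, dotProduct_smul, smul_eq_mul] at h1
    rw [← mul_assoc, ← mul_inv, hs, inv_mul_lt_iff₀ h0, mul_one] at h1
    simp only [star_trivial, sub_mulVec, one_mulVec, dotProduct_sub]
    rw [← mulVec_mulVec, dotProduct_mulVec x, vecMul_transpose]
    linarith

/-- Change of variables `u = exp w` on the positive orthant. -/
lemma aux_cov (n : ℕ) (g : (Fin n → ℝ) → ℝ) (hg : ∀ u, ¬ (∀ i, 0 < u i) → g u = 0) :
    ∫ u, g u = ∫ w : Fin n → ℝ, (∏ i, Real.exp (w i)) * g (fun i => Real.exp (w i)) := by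
  let f : (Fin n → ℝ) → (Fin n → ℝ) := fun w i => Real.exp (w i)
  let f' : (Fin n → ℝ) → ((Fin n → ℝ) →L[ℝ] (Fin n → ℝ)) := fun w =>
    ContinuousLinearMap.pi fun i =>
      (ContinuousLinearMap.toSpanSingleton ℝ (Real.exp (w i))).comp (ContinuousLinearMap.proj i)
  have hf' : ∀ w ∈ (Set.univ : Set (Fin n → ℝ)), HasFDerivWithinAt f (f' w) Set.univ w := by
    intro w _
    apply HasFDerivAt.hasFDerivWithinAt
    rw [hasFDerivAt_pi]
    intro i
    have h1 : HasFDerivAt Real.exp (ContinuousLinearMap.toSpanSingleton ℝ (Real.exp (w i))) (w i) :=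
      (Real.hasDerivAt_exp (w i)).hasFDerivAt
    exact h1.comp w (ContinuousLinearMap.proj (R := ℝ) (φ := fun _ : Fin n => ℝ) i).hasFDerivAt
  have hinj : Set.InjOn f Set.univ := by
    intro a _ b _ hab
    funext i
    exact Real.exp_injective (congrFun hab i)
  have h := integral_image_eq_integral_abs_det_fderiv_smul volume MeasurableSet.univ hf' hinj g
  have himg : ∀ u, u ∉ f '' Set.univ → g u = 0 := by
    intro u hu
    apply hg
    intro hpos
    exact hu ⟨fun i => Real.log (u i), trivial, funext fun i => Real.exp_log (hpos i)⟩
  rw [setIntegral_eq_integral_of_forall_compl_eq_zero himg, setIntegral_univ] at h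
  rw [h]
  congr 1
  funext w
  have : (f' w).det = ∏ i, Real.exp (w i) := by
    simp only [f']
    rw [ContinuousLinearMap.det_pi]
    simp
  rw [this, abs_of_pos (Finset.prod_pos fun i _ => Real.exp_pos _)]
  rfl

/-- If `Z ~ LCFUSN_{n,m}(μ, Σ, Δ)` (i.e. `ln Z ~ CFUSN_{n,m}(μ, Σ, Δ)` componentwise), then
`H_Z = H_{CFUSN_{n,m}(μ,Σ,Δ)} + Σᵢ E(Xᵢ)` where `X ~ CFUSN_{n,m}(μ, Σ, Δ)`. -/
theorem entropy_LCFUSN (n m : ℕ) (μ : Fin n → ℝ)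
    (Sig S : Matrix (Fin n) (Fin n) ℝ) (hS : S.PosDef) (hSS : S * S = Sig)
    (Δ : Matrix (Fin n) (Fin m) ℝ)
    (hΔ : ∀ a : Fin m → ℝ, a ⬝ᵥ a = 1 → (Δ *ᵥ a) ⬝ᵥ (Δ *ᵥ a) < 1)
    (fX fZ : (Fin n → ℝ) → ℝ)
    (hfX : ∀ w, fX w = 2 ^ m * (Real.sqrt Sig.det)⁻¹ * mvphi n 1 (S⁻¹ *ᵥ (w - μ)) *
      mvPhi m (1 - Δᵀ * Δ) (Δᵀ *ᵥ (S⁻¹ *ᵥ (w - μ))))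
    (hfZ : ∀ u : Fin n → ℝ, (∀ i, 0 < u i) →
      fZ u = (∏ i, u i)⁻¹ * fX (fun i => Real.log (u i)))
    (hfZ0 : ∀ u : Fin n → ℝ, ¬ (∀ i, 0 < u i) → fZ u = 0) :
    -∫ u, fZ u * Real.log (fZ u) =
      (-∫ w, fX w * Real.log (fX w)) + ∑ i, (∫ w, w i * fX w) := by
  have hV := aux_posdef n m Δ hΔ
  have hint := aux_mvphi_int m _ hV
  set V := 1 - Δᵀ * Δ with hVdef
  -- bounds on the cdf factor
  obtain ⟨K, hK⟩ : ∃ K, ∀ x, mvPhi m V x ≤ K :=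
    ⟨∫ t, mvphi m V t, fun x => setIntegral_le_integral hint
      (Filter.Eventually.of_forall (aux_mvphi_nonneg m V))⟩
  have hP0 : ∀ x, 0 ≤ mvPhi m V x := fun x =>
    integral_nonneg (aux_mvphi_nonneg m V)
  obtain ⟨M, hM⟩ := (isCompact_Icc (a := (0 : ℝ)) (b := K)).exists_bound_of_continuousOn
    Real.continuous_mul_log.continuousOn
  set A : ℝ := 2 ^ m * (Real.sqrt Sig.det)⁻¹ * ((2 * Real.pi) ^ (-(n : ℝ) / 2)) with hA
  have hA0 : 0 ≤ A := by positivity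
  have hf : ∀ w, fX w = A * Real.exp (-((S⁻¹ *ᵥ (w - μ)) ⬝ᵥ (S⁻¹ *ᵥ (w - μ))) / 2) *
      mvPhi m V (Δᵀ *ᵥ (S⁻¹ *ᵥ (w - μ))) := by
    intro w
    rw [hfX, mvphi, hA]
    simp only [det_one, Real.sqrt_one, inv_one, one_mulVec]
    ring
  have hmeas : Measurable fX := by
    have h1 : Measurable (fun w : Fin n → ℝ => S⁻¹ *ᵥ (w - μ)) :=
      Continuous.measurable (by fun_prop)
    have h2 : Measurable (fun z : Fin n → ℝ => A * Real.exp (-(z ⬝ᵥ z) / 2) *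
        mvPhi m V (Δᵀ *ᵥ z)) := by
      apply Measurable.mul
      · exact Continuous.measurable (by fun_prop)
      · exact (aux_mvPhi_meas m V).comp (Continuous.measurable (by fun_prop))
    have := h2.comp h1
    rwa [show fX = _ from funext hf]
  have hSdet : S.det ≠ 0 := hS.det_pos.ne'
  have hSu : IsUnit S.det := isUnit_iff_ne_zero.mpr hSdet
  have hdom : Integrable (fun w : Fin n → ℝ =>
      (1 + (S⁻¹ *ᵥ (w - μ)) ⬝ᵥ (S⁻¹ *ᵥ (w - μ))) *
        Real.exp (-((S⁻¹ *ᵥ (w - μ)) ⬝ᵥ (S⁻¹ *ᵥ (w - μ))) / 2)) := by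
    have h1 := aux_comp n S⁻¹ hS.inv.det_pos.ne' _ (aux_gauss_sq n)
    exact h1.comp_sub_right μ
  have hK0 : 0 ≤ K := (hP0 0).trans (hK 0)
  -- integrability of the entropy integrand
  have hI1 : Integrable (fun w => fX w * Real.log (fX w)) := by
    refine (hdom.const_mul (A * (K * |Real.log A| + K + M))).mono' ?_ ?_
    · exact (hmeas.mul (Real.measurable_log.comp hmeas)).aestronglyMeasurable
    · filter_upwards with w
      rw [hf w]
      set z := S⁻¹ *ᵥ (w - μ)
      have hP := hP0 (Δᵀ *ᵥ z)
      have hPK := hK (Δᵀ *ᵥ z)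
      have hPM := hM _ ⟨hP, hPK⟩
      generalize mvPhi m V (Δᵀ *ᵥ z) = P at *
      have h0 : 0 ≤ z ⬝ᵥ z := Finset.sum_nonneg fun i _ => mul_self_nonneg _
      generalize z ⬝ᵥ z = q at *
      have hM0 : 0 ≤ M := (norm_nonneg _).trans hPM
      rcases hA0.eq_or_lt with hA1 | hA1
      · simp [← hA1]
      rcases hP.eq_or_lt with hP1 | hP1
      · rw [← hP1]; simp; positivity
      rw [Real.log_mul (by positivity) hP1.ne', Real.log_mul hA1.ne' (by positivity), Real.log_exp]
      have e : A * Real.exp (-q / 2) * P * (Real.log A + -q / 2 + Real.log P) =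
        A * Real.exp (-q / 2) * (P * Real.log A + P * (-q/2) + P * Real.log P) := by ring
      rw [e, norm_mul, Real.norm_of_nonneg (by positivity : 0 ≤ A * Real.exp (-q / 2))]
      have b1 : ‖P * Real.log A‖ ≤ K * |Real.log A| := by
        rw [norm_mul, Real.norm_of_nonneg hP]; exact mul_le_mul_of_nonneg_right hPK (abs_nonneg _)
      have b2 : ‖P * (-q/2)‖ ≤ K * q := by
        rw [norm_mul, Real.norm_of_nonneg hP]
        apply mul_le_mul hPK _ (norm_nonneg _) hK0
        rw [Real.norm_eq_abs, abs_le]; constructor <;> linarith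
      have b3 : ‖P * Real.log A + P * (-q/2) + P * Real.log P‖ ≤
          (K * |Real.log A| + K + M) * (1 + q) := by
        refine (norm_add₃_le).trans ?_
        have : 0 ≤ K * |Real.log A| * q := by positivity
        have : 0 ≤ M * q := by positivity
        nlinarith
      calc _ ≤ A * Real.exp (-q / 2) * ((K * |Real.log A| + K + M) * (1 + q)) := by gcongr
        _ = _ := by ring
  have hI2 : ∀ i, Integrable (fun w : Fin n → ℝ => w i * fX w) := by
    intro i
    refine (hdom.const_mul (A * K * (∑ j, |S i j| + |μ i|))).mono' ?_ ?_
    · exact ((measurable_pi_apply i).mul hmeas).aestronglyMeasurable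
    · filter_upwards with w
      rw [hf w]
      have hw : w i = (∑ j, S i j * (S⁻¹ *ᵥ (w - μ)) j) + μ i := by
        have : S *ᵥ (S⁻¹ *ᵥ (w - μ)) = w - μ := by
          rw [mulVec_mulVec, mul_nonsing_inv _ hSu, one_mulVec]
        have := congrFun this i
        simp only [Pi.sub_apply] at this
        rw [mulVec, dotProduct] at this
        linarith
      set z := S⁻¹ *ᵥ (w - μ)
      have hP := hP0 (Δᵀ *ᵥ z)
      have hPK := hK (Δᵀ *ᵥ z)
      generalize mvPhi m V (Δᵀ *ᵥ z) = P at *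
      have h0 : 0 ≤ z ⬝ᵥ z := Finset.sum_nonneg fun i _ => mul_self_nonneg _
      have hzj : ∀ j, |z j| ≤ 1 + z ⬝ᵥ z := by
        intro j
        have : z j * z j ≤ z ⬝ᵥ z :=
          Finset.single_le_sum (f := fun j => z j * z j) (fun i _ => mul_self_nonneg _)
            (Finset.mem_univ j)
        rw [abs_le]; constructor <;> nlinarith [sq_nonneg (z j - 1), sq_nonneg (z j + 1)]
      have hwb : ‖w i‖ ≤ (∑ j, |S i j| + |μ i|) * (1 + z ⬝ᵥ z) := by
        rw [hw, add_mul, Finset.sum_mul]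
        refine (norm_add_le _ _).trans (add_le_add ?_ ?_)
        · refine (norm_sum_le _ _).trans (Finset.sum_le_sum fun j _ => ?_)
          rw [norm_mul]
          exact mul_le_mul_of_nonneg_left (hzj j) (abs_nonneg _)
        · rw [Real.norm_eq_abs]; nlinarith [abs_nonneg (μ i)]
      generalize z ⬝ᵥ z = q at *
      rw [norm_mul, Real.norm_of_nonneg (by positivity : 0 ≤ A * Real.exp (-q / 2) * P)]
      calc _ ≤ ((∑ j, |S i j| + |μ i|) * (1 + q)) * (A * Real.exp (-q / 2) * K) := by gcongr
        _ = _ := by ring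
  rw [aux_cov n (fun u => fZ u * Real.log (fZ u)) (fun u hu => by simp [hfZ0 u hu])]
  have key : ∀ w : Fin n → ℝ, (∏ i, Real.exp (w i)) *
      (fZ (fun i => Real.exp (w i)) * Real.log (fZ (fun i => Real.exp (w i)))) =
      fX w * Real.log (fX w) - ∑ i, w i * fX w := by
    intro w
    rw [hfZ _ (fun i => Real.exp_pos _)]
    simp only [Real.log_exp]
    rw [← Real.exp_sum, ← Finset.sum_mul]
    have hE := Real.exp_pos (∑ i, w i)
    by_cases h : fX w = 0
    · simp [h]
    · rw [Real.log_mul (by positivity) h, Real.log_inv, Real.log_exp]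
      field_simp
      ring
  simp_rw [key]
  rw [integral_sub hI1 (integrable_finsetSum _ fun i _ => hI2 i),
    integral_finsetSum _ fun i _ => hI2 i]
  ring
end
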